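/- Let A be a constant n×n quaternion matrix. The system ẋ = Ax is stable (at any t₀) if and only if every eigenvalue λ of the complex adjoint matrix χ_A satisfies Re(λ) ≤ 0, and for every eigenvalue λ of χ_A with Re(λ) = 0 its algebraic multiplicity (as a root of the characteristic polynomial of χ_A) equals its geometric multiplicity (the dimension of the kernel of χ_A − λI). -/

import Mathlib

open Matrix Polynomial
open scoped Quaternion

noncomputable section

/-- The two complex components of a quaternion: `q = c1 q + (c2 q) * j`,
identifying `ℂ` with the real span of `1` and `i` in `ℍ`. -/
def Quaternion.c1 (q : ℍ[ℝ]) : ℂ := ⟨q.re, q.imI⟩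

def Quaternion.c2 (q : ℍ[ℝ]) : ℂ := ⟨q.imJ, q.imK⟩

/-- The embedding of `ℂ` into `ℍ` as the real span of `1` and `i`. -/
def Complex.toQuat (z : ℂ) : ℍ[ℝ] := ⟨z.re, z.im, 0, 0⟩

/-- The complex adjoint matrix `χ_A` of a quaternion matrix `A = A₁ + A₂·j`:
the block matrix `[[A₁, A₂], [-conj A₂, conj A₁]]`. -/
def chiMat {n : ℕ} (A : Matrix (Fin n) (Fin n) ℍ[ℝ]) :
    Matrix (Fin n ⊕ Fin n) (Fin n ⊕ Fin n) ℂ :=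
  Matrix.fromBlocks (A.map Quaternion.c1) (A.map Quaternion.c2)
    ((-(A.map Quaternion.c2)).map (starRingEnd ℂ)) ((A.map Quaternion.c1).map (starRingEnd ℂ))

/-- `ρ` is a standard eigenvalue of the quaternion matrix `A`: an eigenvalue of the
complex adjoint matrix `χ_A` with nonnegative imaginary part. -/
def IsStdEigenvalue {n : ℕ} (A : Matrix (Fin n) (Fin n) ℍ[ℝ]) (ρ : ℂ) : Prop :=
  (chiMat A).charpoly.IsRoot ρ ∧ 0 ≤ ρ.im

/-- `s` is the multiset of standard eigenvalues of `A` counted with multiplicity: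
it has `n` elements, all with nonnegative imaginary part, and the characteristic
polynomial of `χ_A` is `∏_{z ∈ s} (X - z)·(X - conj z)`. -/
def IsStdEigs {n : ℕ} (A : Matrix (Fin n) (Fin n) ℍ[ℝ]) (s : Multiset ℂ) : Prop :=
  Multiset.card s = n ∧ (∀ z ∈ s, 0 ≤ z.im) ∧
    (chiMat A).charpoly =
      (s.map (fun z => (X - C z) * (X - C (starRingEnd ℂ z)))).prod

/-- `x : ℝ → ℍ^n` is a solution of the linear quaternionic system `ẋ = A(t)x`. -/
def IsSol {n : ℕ} (A : ℝ → Matrix (Fin n) (Fin n) ℍ[ℝ]) (x : ℝ → Fin n → ℍ[ℝ]) : Prop :=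
  ∀ t : ℝ, HasDerivAt x ((A t).mulVec (x t)) t

/-- The norm `‖x‖ = Σ_k |x_k|` on `ℍ^n`. -/
def vecNorm {n : ℕ} (x : Fin n → ℍ[ℝ]) : ℝ := ∑ k, ‖x k‖

/-- The norm `‖A‖ = Σ_{i,j} |a_{ij}|` on `ℍ^{n×n}`. -/
def matNorm {n : ℕ} (A : Matrix (Fin n) (Fin n) ℍ[ℝ]) : ℝ := ∑ i, ∑ j, ‖A i j‖

/-- Stability (in the sense of Lyapunov) of the system `ẋ = A(t)x` at `t₀`. -/
def StableAt {n : ℕ} (A : ℝ → Matrix (Fin n) (Fin n) ℍ[ℝ]) (t₀ : ℝ) : Prop :=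
  ∀ ε > (0:ℝ), ∃ δ > (0:ℝ), ∀ x : ℝ → Fin n → ℍ[ℝ], IsSol A x →
    vecNorm (x t₀) < δ → ∀ t ≥ t₀, vecNorm (x t) < ε

/-- Asymptotic stability of the system `ẋ = A(t)x` at `t₀`. -/
def AsympStableAt {n : ℕ} (A : ℝ → Matrix (Fin n) (Fin n) ℍ[ℝ]) (t₀ : ℝ) : Prop :=
  StableAt A t₀ ∧ ∃ δ > (0:ℝ), ∀ x : ℝ → Fin n → ℍ[ℝ], IsSol A x →
    vecNorm (x t₀) < δ →
      Filter.Tendsto (fun t => vecNorm (x t)) Filter.atTop (nhds 0)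

/-- `M` is a fundamental matrix of `ẋ = A(t)x`: entrywise `M'(t) = A(t)·M(t)`
and `M(t)` is invertible for every `t`. -/
def IsFundamental {n : ℕ} (A M : ℝ → Matrix (Fin n) (Fin n) ℍ[ℝ]) : Prop :=
  (∀ (t : ℝ) (i j : Fin n), HasDerivAt (fun s => M s i j) ((A t * M t) i j) t) ∧
    ∀ t : ℝ, IsUnit (M t)

section Flow

variable {V : Type*} [NormedAddCommGroup V] [NormedSpace ℂ V]

theorem ContinuousLinearMap.mem_maxGenEigenspace_iff (T : V →L[ℂ] V) (l : ℂ) (w : V) :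
    w ∈ Module.End.maxGenEigenspace (T : Module.End ℂ V) l ↔
      ∃ k : ℕ, ((T - l • 1) ^ k) w = 0 := by
  rw [Module.End.mem_maxGenEigenspace]
  refine exists_congr fun k => ?_
  rw [← ContinuousLinearMap.coe_coe, ContinuousLinearMap.toLinearMap_pow]
  rfl

variable [CompleteSpace V]

theorem exp_smul_apply_of_pow_sub_smul_eq_zero (T : V →L[ℂ] V) (l t : ℂ) (k : ℕ) (w : V)
    (h : ((T - l • 1) ^ k) w = 0) :
    NormedSpace.exp (t • T) w =
      Complex.exp (t * l) •
        ∑ i ∈ Finset.range k, ((i.factorial : ℂ)⁻¹ * t ^ i) • ((T - l • 1) ^ i) w := by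
  let : NormedAlgebra ℚ (V →L[ℂ] V) := NormedAlgebra.restrictScalars ℚ ℂ _
  have hsplit : t • T = algebraMap ℂ (V →L[ℂ] V) (t * l) + t • (T - l • 1) := by
    rw [Algebra.algebraMap_eq_smul_one, smul_sub, smul_smul]; abel
  rw [hsplit, NormedSpace.exp_add_of_commute (Algebra.commutes _ _),
    ← NormedSpace.algebraMap_exp_comm, ← Complex.exp_eq_exp_ℂ, Algebra.algebraMap_eq_smul_one]
  simp only [smul_mul_assoc, one_mul, _root_.smul_apply]
  congr 1
  have hs := (NormedSpace.exp_series_hasSum_exp' (𝕂 := ℂ) (t • (T - l • 1))).mapL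
    (ContinuousLinearMap.apply ℂ V w)
  refine hs.unique ?_
  have hterm : ∀ i : ℕ, ContinuousLinearMap.apply ℂ V w
      ((i.factorial : ℂ)⁻¹ • (t • (T - l • 1)) ^ i) =
      ((i.factorial : ℂ)⁻¹ * t ^ i) • ((T - l • 1) ^ i) w := by
    intro i
    rw [_root_.smul_pow, smul_smul]
    rfl
  simp only [hterm]
  refine hasSum_sum_of_ne_finset_zero fun i hi => ?_
  obtain ⟨m, rfl⟩ := Nat.exists_eq_add_of_le (not_lt.mp (Finset.mem_range.not.mp hi))
  have hz : ((T - l • 1) ^ (k + m)) w = 0 := by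
    rw [add_comm, pow_add, mul_apply_eq_comp, h, map_zero]
  rw [hz, smul_zero]

theorem exists_norm_exp_smul_apply_le_of_re_neg (T : V →L[ℂ] V) (l : ℂ) (hl : l.re < 0) (k : ℕ)
    (w : V) (h : ((T - l • 1) ^ k) w = 0) :
    ∃ C : ℝ, ∀ t : ℝ, 0 ≤ t → ‖NormedSpace.exp ((t : ℂ) • T) w‖ ≤ C := by
  refine ⟨∑ i ∈ Finset.range k, ((-l.re) ^ i)⁻¹ * ‖((T - l • 1) ^ i) w‖, fun t ht => ?_⟩
  rw [exp_smul_apply_of_pow_sub_smul_eq_zero T l t k w h, Finset.smul_sum]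
  refine (norm_sum_le _ _).trans (Finset.sum_le_sum fun i _ => ?_)
  rw [norm_smul, norm_smul, ← mul_assoc]
  gcongr
  have hc : 0 < -l.re := by linarith
  have hexp := Real.pow_div_factorial_le_exp (-l.re * t) (by positivity) i
  have h1 : ‖Complex.exp (t * l)‖ = Real.exp (-(-l.re * t)) := by
    rw [Complex.norm_exp]; congr 1; simp [mul_comm]
  rw [h1, Real.exp_neg]
  simp only [norm_mul, norm_inv, norm_pow, Complex.norm_natCast, Complex.norm_real,
    Real.norm_of_nonneg ht]
  rw [inv_mul_le_iff₀ (Real.exp_pos _)]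
  calc (i.factorial : ℝ)⁻¹ * t ^ i
      = ((-l.re * t) ^ i / i.factorial) * ((-l.re) ^ i)⁻¹ := by
        rw [mul_pow]; field_simp
    _ ≤ _ := by gcongr

theorem norm_exp_smul_apply_of_apply_eq_smul (T : V →L[ℂ] V) (l : ℂ) (w : V)
    (h : T w = l • w) (t : ℝ) :
    ‖NormedSpace.exp ((t : ℂ) • T) w‖ = Real.exp (t * l.re) * ‖w‖ := by
  rw [exp_smul_apply_of_pow_sub_smul_eq_zero T l t 1 w (by simp [h]), norm_smul,
    Complex.norm_exp]
  simp

theorem exists_norm_exp_smul_le_iff (T : V →L[ℂ] V) :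
    (∃ C : ℝ, ∀ t : ℝ, 0 ≤ t → ‖NormedSpace.exp ((t : ℂ) • T)‖ ≤ C) ↔
      ∀ v, ∃ C : ℝ, ∀ t : ℝ, 0 ≤ t → ‖NormedSpace.exp ((t : ℂ) • T) v‖ ≤ C := by
  constructor
  · rintro ⟨C, hC⟩ v
    exact ⟨C * ‖v‖, fun t ht => ContinuousLinearMap.le_of_opNorm_le _ (hC t ht) v⟩
  · intro h
    obtain ⟨C, hC⟩ := banach_steinhaus (g := fun t : Set.Ici (0 : ℝ) =>
      NormedSpace.exp (((t : ℝ) : ℂ) • T)) fun v => by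
        obtain ⟨C, hC⟩ := h v
        exact ⟨C, fun t => hC t t.2⟩
    exact ⟨C, fun t ht => hC ⟨t, ht⟩⟩

theorem forall_exists_norm_exp_smul_apply_le_iff [FiniteDimensional ℂ V] (T : V →L[ℂ] V) :
    (∀ v, ∃ C : ℝ, ∀ t : ℝ, 0 ≤ t → ‖NormedSpace.exp ((t : ℂ) • T) v‖ ≤ C) ↔
      ∀ l : ℂ, Module.End.HasEigenvalue (T : Module.End ℂ V) l →
        l.re ≤ 0 ∧ (l.re = 0 → Module.End.maxGenEigenspace (T : Module.End ℂ V) l ≤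
          Module.End.eigenspace (T : Module.End ℂ V) l) := by
  constructor
  · intro h l hl
    constructor
    · obtain ⟨v, hv, hv0⟩ := hl.exists_hasEigenvector
      have hv : T v = l • v := Module.End.mem_eigenspace_iff.mp hv
      obtain ⟨C, hC⟩ := h v
      by_contra! hre
      have hpos : 0 < ‖v‖ := norm_pos_iff.mpr hv0
      have hC0 : 0 ≤ C := (norm_nonneg _).trans (hC 0 le_rfl)
      have h1 := hC (C / ‖v‖ / l.re) (by positivity)
      rw [norm_exp_smul_apply_of_apply_eq_smul T l v hv, div_mul_cancel₀ _ hre.ne',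
        ← le_div_iff₀ hpos] at h1
      linarith [Real.add_one_le_exp (C / ‖v‖)]
    · intro hre
      have key : ∀ w : V, ((T - l • 1) ^ 2 : V →L[ℂ] V) w = 0 → (T - l • 1) w = 0 := by
        intro w hw
        by_contra h0
        have hpos : 0 < ‖(T - l • 1) w‖ := norm_pos_iff.mpr h0
        obtain ⟨C, hC⟩ := h w
        have hC0 : 0 ≤ C := (norm_nonneg _).trans (hC 0 le_rfl)
        set t : ℝ := (C + ‖w‖ + 1) / ‖(T - l • 1) w‖ with ht
        have ht0 : 0 ≤ t := by positivity
        have h1 := hC t ht0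
        rw [exp_smul_apply_of_pow_sub_smul_eq_zero T l t 2 w hw, norm_smul,
          Complex.norm_exp] at h1
        have h2 : ‖(t : ℂ) • (T - l • 1) w‖ = C + ‖w‖ + 1 := by
          rw [norm_smul, Complex.norm_real, Real.norm_of_nonneg ht0, ht,
            div_mul_cancel₀ _ hpos.ne']
        have h3 := norm_sub_norm_le ((t : ℂ) • (T - l • 1) w) (-w)
        rw [sub_neg_eq_add, norm_neg, h2, add_comm _ w] at h3
        simp [Finset.sum_range_succ, hre] at h1 h3
        linarith
      have hpow : ∀ k : ℕ, ∀ w : V, ((T - l • 1) ^ k : V →L[ℂ] V) w = 0 → (T - l • 1) w = 0 := by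
        intro k
        induction k with
        | zero => intro w hw; simp at hw; simp [hw]
        | succ k ih =>
          intro w hw
          rw [pow_succ, mul_apply_eq_comp] at hw
          exact key w (by rw [pow_two, mul_apply_eq_comp]; exact ih _ hw)
      intro w hw
      obtain ⟨k, hk⟩ := (T.mem_maxGenEigenspace_iff l w).mp hw
      rw [Module.End.mem_eigenspace_iff]
      simpa [sub_eq_zero] using hpow k w hk
  · intro h v
    have hv : v ∈ ⨆ l : ℂ, Module.End.maxGenEigenspace (T : Module.End ℂ V) l := by
      rw [Module.End.iSup_maxGenEigenspace_eq_top]; trivial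
    induction hv using Submodule.iSup_induction' with
    | zero => exact ⟨0, fun t _ => by simp⟩
    | add x y _ _ hx hy =>
      obtain ⟨C, hC⟩ := hx
      obtain ⟨D, hD⟩ := hy
      refine ⟨C + D, fun t ht => ?_⟩
      rw [map_add]
      exact (norm_add_le _ _).trans (add_le_add (hC t ht) (hD t ht))
    | mem l w hw =>
      rcases eq_or_ne w 0 with rfl | hw0
      · exact ⟨0, fun t _ => by simp⟩
      obtain ⟨k, hk⟩ := (T.mem_maxGenEigenspace_iff l w).mp hw
      have hl : Module.End.HasEigenvalue (T : Module.End ℂ V) l := by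
        by_contra hne
        have hbot : Module.End.eigenspace (T : Module.End ℂ V) l = ⊥ := by
          simpa [Module.End.hasEigenvalue_iff] using hne
        refine hw0 (?_ : w = 0)
        have hinj : ∀ x, (T - l • 1) x = 0 → x = 0 := fun x hx => by
          have : x ∈ Module.End.eigenspace (T : Module.End ℂ V) l := by
            rw [Module.End.mem_eigenspace_iff]
            simpa [sub_eq_zero] using hx
          rwa [hbot, Submodule.mem_bot] at this
        clear hw hw0
        induction k with
        | zero => simpa using hk
        | succ k ih =>
          rw [pow_succ', mul_apply_eq_comp] at hk
          exact ih (hinj _ hk)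
      obtain ⟨hre, hss⟩ := h l hl
      rcases hre.lt_or_eq with hlt | heq
      · exact exists_norm_exp_smul_apply_le_of_re_neg T l hlt k w hk
      · refine ⟨‖w‖, fun t _ => ?_⟩
        rw [norm_exp_smul_apply_of_apply_eq_smul T l w
          (Module.End.mem_eigenspace_iff.mp (hss heq hw))]
        simp [heq]

end Flow

section ODE

variable {V : Type*} [NormedAddCommGroup V] [NormedSpace ℂ V]

theorem exp_sub_self_smul_apply (T : V →L[ℂ] V) (v : V) (t₀ : ℝ) :
    NormedSpace.exp (((t₀ - t₀ : ℝ) : ℂ) • T) v = v := by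
  simp

variable [CompleteSpace V]

theorem hasDerivAt_exp_smul_apply (T : V →L[ℂ] V) (v : V) (t₀ t : ℝ) :
    HasDerivAt (fun s : ℝ => NormedSpace.exp (((s - t₀ : ℝ) : ℂ) • T) v)
      (T (NormedSpace.exp (((t - t₀ : ℝ) : ℂ) • T) v)) t := by
  have h : HasDerivAt (fun s : ℝ => NormedSpace.exp ((s : ℂ) • T))
      (T * NormedSpace.exp (((t - t₀ : ℝ) : ℂ) • T)) (t - t₀) := by
    exact ((hasDerivAt_exp_smul_const' (𝕂 := ℂ) T ((t - t₀ : ℝ) : ℂ)).scomp (t - t₀)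
      Complex.ofRealCLM.hasDerivAt).congr_deriv (by simp)
  have h' := h.comp_sub_const t t₀
  exact ((ContinuousLinearMap.apply ℂ V v).restrictScalars ℝ).hasFDerivAt.comp_hasDerivAt t h'

theorem eq_exp_smul_apply_of_hasDerivAt (T : V →L[ℂ] V) (y : ℝ → V)
    (hy : ∀ t, HasDerivAt y (T (y t)) t) (t₀ t : ℝ) :
    y t = NormedSpace.exp (((t - t₀ : ℝ) : ℂ) • T) (y t₀) := by
  refine congrFun (ODE_solution_unique_univ (v := fun _ => T) (s := fun _ => Set.univ)
    (t₀ := t₀) (fun _ => T.lipschitz.lipschitzOnWith)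
    (fun t => ⟨hy t, trivial⟩)
    (fun t => ⟨hasDerivAt_exp_smul_apply T (y t₀) t₀ t, trivial⟩) ?_) t
  simp

end ODE

/-- The real-linear identification `x₁ + x₂ j ↦ (x₁, -conj x₂)` of `ℍⁿ` with `ℂ²ⁿ`. -/
def quatVecEquiv (n : ℕ) : (Fin n → ℍ[ℝ]) ≃ₗ[ℝ] (Fin n ⊕ Fin n → ℂ) where
  toFun x := Sum.elim (fun i => (x i).c1) (fun i => -(starRingEnd ℂ) (x i).c2)
  invFun y i := ⟨(y (.inl i)).re, (y (.inl i)).im, -(y (.inr i)).re, (y (.inr i)).im⟩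
  map_add' x y := by
    ext (i | i) <;> apply Complex.ext <;> simp [Quaternion.c1, Quaternion.c2, add_comm]
  map_smul' r x := by
    ext (i | i) <;> apply Complex.ext <;> simp [Quaternion.c1, Quaternion.c2]
  left_inv x := by
    funext i; ext <;> simp [Quaternion.c1, Quaternion.c2]
  right_inv y := by
    ext (i | i) <;> apply Complex.ext <;> simp [Quaternion.c1, Quaternion.c2]

theorem quatVecEquiv_inl {n : ℕ} (x : Fin n → ℍ[ℝ]) (i : Fin n) :
    quatVecEquiv n x (.inl i) = (x i).c1 := rfl

theorem quatVecEquiv_inr {n : ℕ} (x : Fin n → ℍ[ℝ]) (i : Fin n) :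
    quatVecEquiv n x (.inr i) = -(starRingEnd ℂ) (x i).c2 := rfl

theorem Quaternion.c1_sum {ι : Type*} (s : Finset ι) (f : ι → ℍ[ℝ]) :
    (∑ j ∈ s, f j).c1 = ∑ j ∈ s, (f j).c1 :=
  let φ : ℍ[ℝ] →+ ℂ := AddMonoidHom.mk' Quaternion.c1 fun a b => by
    apply Complex.ext <;> simp [Quaternion.c1]
  map_sum φ f s

theorem Quaternion.c2_sum {ι : Type*} (s : Finset ι) (f : ι → ℍ[ℝ]) :
    (∑ j ∈ s, f j).c2 = ∑ j ∈ s, (f j).c2 :=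
  let φ : ℍ[ℝ] →+ ℂ := AddMonoidHom.mk' Quaternion.c2 fun a b => by
    apply Complex.ext <;> simp [Quaternion.c2]
  map_sum φ f s

theorem quatVecEquiv_mulVec {n : ℕ} (A : Matrix (Fin n) (Fin n) ℍ[ℝ]) (x : Fin n → ℍ[ℝ]) :
    quatVecEquiv n (A.mulVec x) = (chiMat A).mulVec (quatVecEquiv n x) := by
  have hsum : A.mulVec x = fun i => ∑ j, A i j * x j := rfl
  ext (i | i)
  · simp only [quatVecEquiv_inl, quatVecEquiv_inr,
      hsum, Quaternion.c1_sum, chiMat, Matrix.mulVec, dotProduct, Fintype.sum_sum_type, fromBlocks_apply₁₁,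
      fromBlocks_apply₁₂, map_apply, ← Finset.sum_add_distrib]
    refine Finset.sum_congr rfl fun j _ => ?_
    apply Complex.ext <;> simp [Quaternion.c1, Quaternion.c2] <;> ring
  · simp only [quatVecEquiv_inl, quatVecEquiv_inr,
      hsum, Quaternion.c2_sum, chiMat, Matrix.mulVec, dotProduct, Fintype.sum_sum_type, fromBlocks_apply₂₁,
      fromBlocks_apply₂₂, map_apply, ← Finset.sum_add_distrib, map_sum,
      ← Finset.sum_neg_distrib]
    refine Finset.sum_congr rfl fun j _ => ?_
    apply Complex.ext <;> simp [Quaternion.c1, Quaternion.c2] <;> ring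

theorem norm_le_vecNorm {n : ℕ} (x : Fin n → ℍ[ℝ]) : ‖x‖ ≤ vecNorm x :=
  (pi_norm_le_iff_of_nonneg (Finset.sum_nonneg fun _ _ => norm_nonneg _)).mpr fun i =>
    Finset.single_le_sum (f := fun k => ‖x k‖) (fun _ _ => norm_nonneg _) (Finset.mem_univ i)

theorem vecNorm_le {n : ℕ} (x : Fin n → ℍ[ℝ]) : vecNorm x ≤ n * ‖x‖ :=
  (Finset.sum_le_sum fun k _ => norm_le_pi_norm x k).trans (by simp)

/-- `χ_A` as a continuous linear operator on `ℂ²ⁿ`. -/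
def chiCLM {n : ℕ} (A : Matrix (Fin n) (Fin n) ℍ[ℝ]) :
    (Fin n ⊕ Fin n → ℂ) →L[ℂ] (Fin n ⊕ Fin n → ℂ) :=
  LinearMap.toContinuousLinearMap (Matrix.toLin' (chiMat A))

theorem chiCLM_quatVecEquiv {n : ℕ} (A : Matrix (Fin n) (Fin n) ℍ[ℝ]) (x : Fin n → ℍ[ℝ]) :
    chiCLM A (quatVecEquiv n x) = quatVecEquiv n (A.mulVec x) := by
  rw [quatVecEquiv_mulVec]; rfl

theorem isSol_iff {n : ℕ} (A : Matrix (Fin n) (Fin n) ℍ[ℝ]) (x : ℝ → Fin n → ℍ[ℝ]) (t₀ : ℝ) :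
    IsSol (fun _ => A) x ↔ ∀ t, quatVecEquiv n (x t) =
      NormedSpace.exp (((t - t₀ : ℝ) : ℂ) • chiCLM A) (quatVecEquiv n (x t₀)) := by
  let e := (quatVecEquiv n).toContinuousLinearEquiv
  constructor
  · intro hx
    refine eq_exp_smul_apply_of_hasDerivAt (chiCLM A) (fun t => quatVecEquiv n (x t))
      (fun t => ?_) t₀
    rw [chiCLM_quatVecEquiv]
    exact e.hasFDerivAt.comp_hasDerivAt t (hx t)
  · intro h t
    have hd := hasDerivAt_exp_smul_apply (chiCLM A) (quatVecEquiv n (x t₀)) t₀ t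
    simp only [← h, chiCLM_quatVecEquiv] at hd
    have hd' : HasDerivAt (fun s => e.symm (e (x s))) (e.symm (e (A.mulVec (x t)))) t :=
      e.symm.hasFDerivAt.comp_hasDerivAt t hd
    simpa only [e.symm_apply_apply] using hd'

theorem stableAt_iff_forall_exists_norm_exp_le {n : ℕ} (A : Matrix (Fin n) (Fin n) ℍ[ℝ])
    (t₀ : ℝ) : StableAt (fun _ => A) t₀ ↔
      ∀ v, ∃ C : ℝ, ∀ t : ℝ, 0 ≤ t → ‖NormedSpace.exp ((t : ℂ) • chiCLM A) v‖ ≤ C := by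
  let e := (quatVecEquiv n).toContinuousLinearEquiv
  let S : (Fin n ⊕ Fin n → ℂ) →L[ℝ] (Fin n → ℍ[ℝ]) := e.symm
  let R : (Fin n → ℍ[ℝ]) →L[ℝ] (Fin n ⊕ Fin n → ℂ) := e
  constructor
  · intro h v
    obtain ⟨δ, hδ, h⟩ := h 1 one_pos
    obtain ⟨c, hc, hcδ⟩ : ∃ c : ℝ, 0 < c ∧ n * (c * ‖e.symm v‖) < δ := by
      refine ⟨δ / (n * ‖e.symm v‖ + 1), by positivity, ?_⟩
      rw [← mul_assoc, mul_comm (n : ℝ), mul_assoc, div_mul_eq_mul_div,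
        div_lt_iff₀ (by positivity)]
      linarith
    refine ⟨‖R‖ * 1 / c, fun t ht => ?_⟩
    let x : ℝ → Fin n → ℍ[ℝ] := fun s =>
      e.symm (NormedSpace.exp (((s - t₀ : ℝ) : ℂ) • chiCLM A) (c • v))
    have hx0 : x t₀ = c • e.symm v := by
      simp only [x, exp_sub_self_smul_apply, map_smul]
    have hex : ∀ s, quatVecEquiv n (x s) =
        NormedSpace.exp (((s - t₀ : ℝ) : ℂ) • chiCLM A) (c • v) :=
      fun s => e.apply_symm_apply _
    have hsol : IsSol (fun _ => A) x := by
      rw [isSol_iff A x t₀]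
      intro s
      rw [hex s, hex t₀, exp_sub_self_smul_apply]
    have hlt := h x hsol (by
      refine (vecNorm_le _).trans_lt ?_
      rwa [hx0, norm_smul, Real.norm_of_nonneg hc.le]) (t₀ + t) (by linarith)
    have hb := R.le_of_opNorm_le le_rfl (x (t₀ + t))
    have hR : R (x (t₀ + t)) = c • NormedSpace.exp ((t : ℂ) • chiCLM A) v := by
      refine (hex _).trans ?_
      rw [add_sub_cancel_left, ← Complex.coe_smul c v, map_smul, Complex.coe_smul]
    rw [hR, norm_smul, Real.norm_of_nonneg hc.le] at hb
    rw [le_div_iff₀ hc, mul_comm]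
    exact hb.trans (by gcongr; exact (norm_le_vecNorm _).trans hlt.le)
  · intro h ε hε
    obtain ⟨C, hC⟩ := (exists_norm_exp_smul_le_iff _).mpr h
    have hC0 : 0 ≤ C := (norm_nonneg _).trans (hC 0 le_rfl)
    set K : ℝ := n * (‖S‖ * (C * ‖R‖)) with hK
    have hK0 : 0 ≤ K := by positivity
    refine ⟨ε / (K + 1), by positivity, fun x hx hx0 t ht => ?_⟩
    have hxt := (isSol_iff A x t₀).mp hx t
    have hxS : x t = S (NormedSpace.exp (((t - t₀ : ℝ) : ℂ) • chiCLM A) (R (x t₀))) :=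
      (e.eq_symm_apply).mpr hxt
    have hbound : vecNorm (x t) ≤ K * vecNorm (x t₀) := by
      calc vecNorm (x t) ≤ n * ‖x t‖ := vecNorm_le _
        _ ≤ n * (‖S‖ * (C * (‖R‖ * ‖x t₀‖))) := by
          rw [hxS]
          gcongr
          refine S.le_opNorm_of_le ?_
          refine (ContinuousLinearMap.le_of_opNorm_le _ (hC _ (sub_nonneg.mpr ht)) _).trans ?_
          gcongr
          exact R.le_opNorm _
        _ = K * ‖x t₀‖ := by rw [hK]; ring
        _ ≤ K * vecNorm (x t₀) := by gcongr; exact norm_le_vecNorm _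
    rw [lt_div_iff₀ (by positivity)] at hx0
    have : 0 ≤ vecNorm (x t₀) := (norm_nonneg _).trans (norm_le_vecNorm _)
    linarith

theorem maxGenEigenspace_le_eigenspace_iff {V : Type*} [AddCommGroup V] [Module ℂ V]
    [FiniteDimensional ℂ V] (f : Module.End ℂ V) (l : ℂ) :
    f.maxGenEigenspace l ≤ f.eigenspace l ↔
      f.charpoly.rootMultiplicity l = Module.finrank ℂ (f.eigenspace l) := by
  rw [← LinearMap.finrank_maxGenEigenspace_eq]
  have hle : f.eigenspace l ≤ f.maxGenEigenspace l :=
    (f.genEigenspace l).monotone le_top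
  exact ⟨fun h => by rw [le_antisymm h hle],
    fun h => (Submodule.eq_of_le_of_finrank_eq hle h.symm).ge⟩

/-- `ẋ = Ax` is stable iff every eigenvalue of `χ_A` has `Re ≤ 0` and every
eigenvalue with `Re = 0` has equal algebraic and geometric multiplicities. -/
theorem stmt6 {n : ℕ} (A : Matrix (Fin n) (Fin n) ℍ[ℝ]) (t₀ : ℝ) :
    StableAt (fun _ => A) t₀ ↔
      ∀ l : ℂ, (chiMat A).charpoly.IsRoot l →
        l.re ≤ 0 ∧ (l.re = 0 →
          (chiMat A).charpoly.rootMultiplicity l =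
            Module.finrank ℂ (LinearMap.ker (Matrix.toLin' (chiMat A - l • 1)))) := by
  rw [stableAt_iff_forall_exists_norm_exp_le, forall_exists_norm_exp_smul_apply_le_iff]
  have hT : ((chiCLM A : (Fin n ⊕ Fin n → ℂ) →L[ℂ] _) : Module.End ℂ (Fin n ⊕ Fin n → ℂ)) =
    Matrix.toLin' (chiMat A) := rfl
  have hker : ∀ l : ℂ, Module.finrank ℂ (LinearMap.ker (Matrix.toLin' (chiMat A - l • 1))) =
      Module.finrank ℂ (Module.End.eigenspace (Matrix.toLin' (chiMat A)) l) := fun l => by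
    rw [Module.End.eigenspace_def, map_sub, map_smul, Matrix.toLin'_one]
    rfl
  simp only [hT, Module.End.hasEigenvalue_iff_isRoot_charpoly, maxGenEigenspace_le_eigenspace_iff,
    Matrix.charpoly_toLin', hker]
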